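/- Let p be a fixed point of J, let q be the next fixed point after p (i.e., q is a fixed point, q > p, and there is no fixed point strictly between p and q), and let m̄ be the 2-adic valuation of 3·p + 2. Define L := p if m̄ = 0, and L := 3^{m̄−1}·(3·p + 2)/2^{m̄} − 1 if m̄ ≥ 1. Then for every n with L < n ≤ q, one has J(n) = 3·n − 2·q. -/

import Mathlib

/-- The Josephus function with reduction constant 3:
`J 1 = 1` and `J n = ((J (n-1) + 2) % n) + 1` for `n ≥ 2`. -/
def J : ℕ → ℕ
  | 0 => 0
  | 1 => 1
  | n + 2 => (J (n + 1) + 2) % (n + 2) + 1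

/-- `n ≥ 1` is a high extremal point if `J n ∈ {n-1, n}`. -/
def IsHighExtremal (n : ℕ) : Prop := 1 ≤ n ∧ (J n = n - 1 ∨ J n = n)

theorem J_succ (n : ℕ) (hn : 1 ≤ n) : J (n + 1) = (J n + 2) % (n + 1) + 1 := by
  obtain ⟨k, rfl⟩ := Nat.exists_eq_add_of_le' hn
  rfl

/-- While `n - J n` stays at least two, `J` grows by three at each step. -/
theorem J_add_of_two_mul_le (a c : ℕ) (ha : 1 ≤ a) (h : J a + c = a) (k : ℕ) (hk : 2 * k ≤ c) :
    J (a + k) + c = a + 3 * k := by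
  induction k with
  | zero => simpa using h
  | succ k ih =>
    have ih' := ih (by omega)
    rw [← add_assoc, J_succ _ (by omega), Nat.mod_eq_of_lt (by omega)]
    omega

theorem J_succ_of_fixed (p : ℕ) (hp : 2 ≤ p) (h : J p = p) : J (p + 1) = 2 := by
  rw [J_succ p (by omega), h, show p + 2 = 1 + (p + 1) by ring, Nat.add_mod_right,
    Nat.mod_eq_of_lt (by omega)]

theorem J_succ_of_pure (e : ℕ) (h : J e + 1 = e) : J (e + 1) = 1 := by
  rw [J_succ e (by omega), show J e + 2 = e + 1 by omega, Nat.mod_self]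

/-- From a pure high extremal point `e` with `e + 1 = 2 ^ m * t`, the pure high extremal points
continue up to `3 ^ m * t - 1`, with no fixed point on the way. -/
theorem pure_chain (m : ℕ) : ∀ t e f : ℕ, J e + 1 = e → e + 1 = 2 ^ m * t → f + 1 = 3 ^ m * t →
    J f + 1 = f ∧ ∀ k, e < k → k ≤ f → J k ≠ k := by
  induction m with
  | zero =>
    intro t e f he het hft
    obtain rfl : e = f := by simp at het hft; omega
    exact ⟨he, fun k h1 h2 => by omega⟩
  | succ m ih =>
    intro t e f he het hft
    have h1 := J_succ_of_pure e he
    obtain ⟨u, hu⟩ : ∃ u, u = 2 ^ m * t := ⟨_, rfl⟩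
    have heu : e + 1 = 2 * u := by rw [het, hu]; ring
    have run := J_add_of_two_mul_le (e + 1) e (by omega) (by omega)
    have hnext := run (u - 1) (by omega)
    obtain ⟨hf, hno⟩ := ih (3 * t) (e + 1 + (u - 1)) f (by omega)
      (by rw [show 2 ^ m * (3 * t) = 3 * u by rw [hu]; ring]; omega)
      (by rw [hft]; ring)
    refine ⟨hf, fun k hk1 hk2 => ?_⟩
    by_cases hk : k ≤ e + 1 + (u - 1)
    · have := run (k - (e + 1)) (by omega)
      rw [show e + 1 + (k - (e + 1)) = k by omega] at this
      omega
    · exact hno k (by omega) hk2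

/-- If `L + 1 - J (L + 1)` is the even number `2 * r`, then `J` is linear up to the next fixed
point `q = L + 1 + r`. -/
theorem J_linear_of_even (L r q : ℕ) (h : J (L + 1) + 2 * r = L + 1) (hq : J q = q) (hLq : L < q)
    (hnext : ∀ k, L < k → k < q → J k ≠ k) (n : ℕ) (hLn : L < n) (hnq : n ≤ q) :
    (J n : ℤ) = 3 * (n : ℤ) - 2 * (q : ℤ) := by
  have run := J_add_of_two_mul_le (L + 1) (2 * r) (by omega) h
  have hend := run r le_rfl
  have hle : q ≤ L + 1 + r := by
    by_contra! hlt
    exact hnext (L + 1 + r) (by omega) hlt (by omega)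
  have hJq := run (q - (L + 1)) (by omega)
  have hJn := run (n - (L + 1)) (by omega)
  rw [show L + 1 + (q - (L + 1)) = q by omega] at hJq
  rw [show L + 1 + (n - (L + 1)) = n by omega] at hJn
  omega

theorem stmt_16 (p q : ℕ) (hp1 : 1 ≤ p) (hp : J p = p)
    (hq : J q = q) (hlt : p < q)
    (hnext : ∀ k, p < k → k < q → J k ≠ k)
    (mbar : ℕ) (hmbar : mbar = padicValNat 2 (3 * p + 2))
    (L : ℕ)
    (hL : L = if mbar = 0 then p else 3 ^ (mbar - 1) * (3 * p + 2) / 2 ^ mbar - 1) :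
    ∀ n, L < n → n ≤ q → (J n : ℤ) = 3 * (n : ℤ) - 2 * (q : ℤ) := by
  have hp2 : p = 1 ∨ 2 ≤ p := by omega
  have hsucc : J (p + 1) = 2 := by
    rcases hp2 with rfl | h
    · rfl
    · exact J_succ_of_fixed p h hp
  obtain ⟨t, ht⟩ : 2 ^ mbar ∣ 3 * p + 2 := hmbar ▸ pow_padicValNat_dvd
  have htodd : ¬ 2 ∣ t := by
    rintro ⟨s, rfl⟩
    refine pow_succ_padicValNat_not_dvd (p := 2) (n := 3 * p + 2) (by omega) ?_
    rw [← hmbar]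
    exact ⟨s, by rw [ht]; ring⟩
  rcases mbar with _ | m
  · obtain rfl : L = p := by simpa using hL
    exact J_linear_of_even L ((L - 1) / 2) q (by simp at ht; omega) hq hlt hnext
  · have hL' : L = 3 ^ m * t - 1 := by
      rw [hL, if_neg (by omega), ht, Nat.add_sub_cancel,
        show 3 ^ m * (2 ^ (m + 1) * t) = 3 ^ m * t * 2 ^ (m + 1) by ring,
        Nat.mul_div_cancel _ (by positivity)]
    have ht0 : 0 < t := by omega
    have hpos : 0 < 3 ^ m * t := by positivity
    obtain ⟨u, hu⟩ : ∃ u, u = 2 ^ m * t := ⟨_, rfl⟩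
    have hpu : 3 * p + 2 = 2 * u := by rw [ht, hu]; ring
    have run := J_add_of_two_mul_le (p + 1) (p - 1) (by omega) (by omega)
    have he := run ((p - 2) / 2) (by omega)
    obtain ⟨hLpure, hno⟩ := pure_chain m t (p + 1 + (p - 2) / 2) L (by omega)
      (by rw [← hu]; omega) (by omega)
    have hLq : L < q := by
      by_contra! hqL
      by_cases hqe : q ≤ p + 1 + (p - 2) / 2
      · have hJq := run (q - (p + 1)) (by omega)
        rw [show p + 1 + (q - (p + 1)) = q by omega] at hJq
        omega
      · exact hno q (by omega) hqL hq
    have hmod : (3 ^ m * t) % 2 = 1 := by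
      rw [Nat.mul_mod, Nat.pow_mod]
      simp
      omega
    have hLsucc := J_succ_of_pure L hLpure
    have hpL : p ≤ L := by
      have : 2 ^ m * t ≤ 3 ^ m * t := Nat.mul_le_mul_right _ (Nat.pow_le_pow_left (by omega) m)
      omega
    exact J_linear_of_even L (L / 2) q (by omega) hq hLq
      fun k hk1 hk2 => hnext k (by omega) hk2
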